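/- Let β, k, D > 0. Then the total mass of the power spectral density S̃(ω) = 2D/((k − ω²)² + β²ω²) of the linear stochastic oscillator is ∫_{−∞}^{∞} 2D/((k − ω²)² + β²ω²) dω = 2πD/(β·k). In particular, when D = k·β this total mass equals 2π, consistent with unit stationary variance of the displacement. -/

import Mathlib

open MeasureTheory Real

open Set in
/-- The map `x ↦ (x - k / x) / β` sends `(0, ∞)` onto the real line. -/
lemma image_sub_div_Ioi {β k : ℝ} (hβ : 0 < β) (hk : 0 < k) :
    (fun x : ℝ ↦ (x - k / x) / β) '' Ioi 0 = univ := by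
  refine eq_univ_of_forall fun u ↦ ?_
  have hs := sq_sqrt (show 0 ≤ (β * u) ^ 2 + 4 * k by positivity)
  have hlt : |β * u| < √((β * u) ^ 2 + 4 * k) := by
    rw [← sqrt_sq_eq_abs]
    exact sqrt_lt_sqrt (sq_nonneg _) (by linarith)
  set s := √((β * u) ^ 2 + 4 * k)
  have hx : 0 < (β * u + s) / 2 := by linarith [neg_abs_le (β * u)]
  refine ⟨(β * u + s) / 2, hx, ?_⟩
  have h : k / ((β * u + s) / 2) = (s - β * u) / 2 := by
    rw [div_eq_iff hx.ne']
    linarith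
  simp only [h]
  field_simp
  ring

open Set in
lemma injOn_sub_div_Ioi {β k : ℝ} (hβ : 0 < β) (hk : 0 < k) :
    InjOn (fun x : ℝ ↦ (x - k / x) / β) (Ioi 0) := by
  refine StrictMonoOn.injOn fun x hx y _ hxy ↦ ?_
  have : k / y < k / x := div_lt_div_of_pos_left hk hx hxy
  exact div_lt_div_of_pos_right (by linarith) hβ

lemma psd_denominator_pos {β k : ℝ} (hβ : 0 < β) {x : ℝ} (hx : 0 < x) :
    0 < (k - x ^ 2) ^ 2 + β ^ 2 * x ^ 2 := by
  positivity

open Set in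
lemma integrableOn_and_integral_add_sq_div {β k : ℝ} (hβ : 0 < β) (hk : 0 < k) :
    IntegrableOn (fun x : ℝ ↦ (k + x ^ 2) / ((k - x ^ 2) ^ 2 + β ^ 2 * x ^ 2)) (Ioi 0) ∧
    ∫ x in Ioi (0 : ℝ), (k + x ^ 2) / ((k - x ^ 2) ^ 2 + β ^ 2 * x ^ 2) = π / β := by
  have hderiv : ∀ x ∈ Ioi (0 : ℝ), HasDerivWithinAt (fun x : ℝ ↦ (x - k / x) / β)
      ((1 + k / x ^ 2) / β) (Ioi 0) x := fun x hx ↦ by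
    have hx0 : x ≠ 0 := (mem_Ioi.1 hx).ne'
    have h := (((hasDerivAt_id' x).fun_sub
      ((hasDerivAt_const x k).fun_div (hasDerivAt_id' x) hx0)).div_const β)
    exact (h.congr_deriv (by ring)).hasDerivWithinAt
  have heq : EqOn (fun x : ℝ ↦ |(1 + k / x ^ 2) / β| • (1 + ((x - k / x) / β) ^ 2)⁻¹)
      (fun x ↦ β * ((k + x ^ 2) / ((k - x ^ 2) ^ 2 + β ^ 2 * x ^ 2))) (Ioi 0) := fun x hx ↦ by
    have hx0 : 0 < x := hx
    have hQ := psd_denominator_pos (k := k) hβ hx0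
    have h : 1 + ((x - k / x) / β) ^ 2 =
        ((k - x ^ 2) ^ 2 + β ^ 2 * x ^ 2) / (β ^ 2 * x ^ 2) := by
      field_simp
      ring
    simp only [smul_eq_mul]
    rw [h, abs_of_pos (by positivity)]
    field_simp
    ring
  have hinj := injOn_sub_div_Ioi hβ hk
  constructor
  · have h := integrableOn_image_iff_integrableOn_abs_deriv_smul measurableSet_Ioi hderiv hinj
      (fun u : ℝ ↦ (1 + u ^ 2)⁻¹)
    rw [image_sub_div_Ioi hβ hk, integrableOn_univ,
      integrableOn_congr_fun heq measurableSet_Ioi] at h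
    exact (integrable_const_mul_iff (isUnit_iff_ne_zero.2 hβ.ne') _).1
      (h.1 integrable_inv_one_add_sq)
  · have h := integral_image_eq_integral_abs_deriv_smul measurableSet_Ioi hderiv hinj
      (fun u : ℝ ↦ (1 + u ^ 2)⁻¹)
    rw [image_sub_div_Ioi hβ hk, setIntegral_univ, integral_univ_inv_one_add_sq,
      setIntegral_congr_fun measurableSet_Ioi heq, integral_const_mul] at h
    rw [h, mul_div_cancel_left₀ _ hβ.ne']

open Set in
/-- The inversion `x ↦ k / x` exchanges the two summands of
`integrableOn_and_integral_add_sq_div`. -/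
lemma integral_sq_div_eq {β k : ℝ} (hβ : 0 < β) (hk : 0 < k) :
    ∫ x in Ioi (0 : ℝ), x ^ 2 / ((k - x ^ 2) ^ 2 + β ^ 2 * x ^ 2) =
    ∫ x in Ioi (0 : ℝ), k / ((k - x ^ 2) ^ 2 + β ^ 2 * x ^ 2) := by
  have hderiv : ∀ x ∈ Ioi (0 : ℝ), HasDerivWithinAt (fun x : ℝ ↦ k / x)
      (-(k / x ^ 2)) (Ioi 0) x := fun x hx ↦ by
    have h := (hasDerivAt_const x k).fun_div (hasDerivAt_id' x) (mem_Ioi.1 hx).ne'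
    exact (h.congr_deriv (by ring)).hasDerivWithinAt
  have himage : (fun x : ℝ ↦ k / x) '' Ioi 0 = Ioi 0 := by
    refine Subset.antisymm (image_subset_iff.2 fun x hx ↦ div_pos hk hx) fun y hy ↦ ?_
    exact ⟨k / y, div_pos hk hy, div_div_cancel₀ hk.ne'⟩
  have hinj : InjOn (fun x : ℝ ↦ k / x) (Ioi 0) :=
    StrictAntiOn.injOn fun x hx y _ hxy ↦ div_lt_div_of_pos_left hk hx hxy
  have h := integral_image_eq_integral_abs_deriv_smul measurableSet_Ioi hderiv hinj
    (fun x : ℝ ↦ k / ((k - x ^ 2) ^ 2 + β ^ 2 * x ^ 2))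
  rw [himage] at h
  rw [h]
  refine setIntegral_congr_fun measurableSet_Ioi fun x hx ↦ ?_
  have hx0 : 0 < x := hx
  have hQ := psd_denominator_pos (k := k) hβ hx0
  have hQ' : (k - (k / x) ^ 2) ^ 2 + β ^ 2 * (k / x) ^ 2 =
      k ^ 2 * ((k - x ^ 2) ^ 2 + β ^ 2 * x ^ 2) / x ^ 4 := by
    field_simp
    ring
  simp only [smul_eq_mul]
  rw [hQ', abs_neg, abs_of_pos (by positivity)]
  field_simp

open Set in
lemma integral_Ioi_div_psd_denominator {β k : ℝ} (hβ : 0 < β) (hk : 0 < k) :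
    ∫ x in Ioi (0 : ℝ), k / ((k - x ^ 2) ^ 2 + β ^ 2 * x ^ 2) = π / (2 * β) := by
  obtain ⟨hint, hval⟩ := integrableOn_and_integral_add_sq_div hβ hk
  have hintk : IntegrableOn (fun x : ℝ ↦ k / ((k - x ^ 2) ^ 2 + β ^ 2 * x ^ 2)) (Ioi 0) := by
    refine hint.mono' (Measurable.aestronglyMeasurable (by fun_prop)) (ae_of_all _ fun x ↦ ?_)
    rw [norm_of_nonneg (by positivity)]
    gcongr
    nlinarith [sq_nonneg x]
  have hintsq : IntegrableOn (fun x : ℝ ↦ x ^ 2 / ((k - x ^ 2) ^ 2 + β ^ 2 * x ^ 2)) (Ioi 0) :=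
    (hint.sub hintk).congr (ae_of_all _ fun x ↦ by simp [add_div])
  simp_rw [add_div] at hval
  rw [integral_add hintk hintsq, integral_sq_div_eq hβ hk] at hval
  rw [mul_comm, ← div_div]
  linarith

/-- Total mass of the power spectral density of the linear stochastic oscillator:
`∫_ℝ 2D/((k − ω²)² + β²ω²) dω = 2πD/(βk)`, and in particular when `D = kβ` this equals `2π`. -/
theorem psd_total_mass
    (β k D : ℝ) (hβ : 0 < β) (hk : 0 < k) (hD : 0 < D) :
    (∫ ω : ℝ, 2 * D / ((k - ω ^ 2) ^ 2 + β ^ 2 * ω ^ 2) = 2 * π * D / (β * k)) ∧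
    (D = k * β → ∫ ω : ℝ, 2 * D / ((k - ω ^ 2) ^ 2 + β ^ 2 * ω ^ 2) = 2 * π) := by
  have hmain : ∫ ω : ℝ, 2 * D / ((k - ω ^ 2) ^ 2 + β ^ 2 * ω ^ 2) = 2 * π * D / (β * k) := by
    have heven := integral_comp_abs (f := fun x : ℝ ↦ k / ((k - x ^ 2) ^ 2 + β ^ 2 * x ^ 2))
    simp only [sq_abs] at heven
    rw [integral_Ioi_div_psd_denominator hβ hk] at heven
    have hscale (ω : ℝ) : 2 * D / ((k - ω ^ 2) ^ 2 + β ^ 2 * ω ^ 2) =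
        2 * D / k * (k / ((k - ω ^ 2) ^ 2 + β ^ 2 * ω ^ 2)) := by
      field_simp
    simp_rw [hscale]
    rw [integral_const_mul, heven]
    field_simp
  refine ⟨hmain, fun h ↦ ?_⟩
  rw [hmain, h]
  field_simp
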